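/- arXiv:1806.09375 — 8 statements merged into one kernel-verified Lean document; each statement's English description precedes it below -/
import Mathlib

section
/- Let A be an r × r real matrix with columns A_1, …, A_r, regarded as vectors of Euclidean space ℝ^r. If Width(A_1,…,A_r) > 0, then A is invertible and every entry B_{kj} of its inverse B = A⁻¹ satisfies |B_{kj}| ≤ 1 / Width(A_1,…,A_r). -/
/-- The minimal height (Width) of a tuple of points in a real normed vector space:
the minimum over `j` of the distance from `a j` to the span of the remaining points. -/
noncomputable def width {V : Type*} [NormedAddCommGroup V] [NormedSpace ℝ V]
    {m : ℕ} (a : Fin m → V) : ℝ :=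
  ⨅ j : Fin m, Metric.infDist (a j)
    (Submodule.span ℝ (a '' {i | i ≠ j}) : Set V)

/-- The columns of an `r × r` real matrix, regarded as vectors of Euclidean space `ℝ^r`. -/
noncomputable def matrixColumns {r : ℕ} (A : Matrix (Fin r) (Fin r) ℝ) :
    Fin r → EuclideanSpace ℝ (Fin r) :=
  fun j => (WithLp.equiv 2 (Fin r → ℝ)).symm (fun k => A k j)

theorem width_le_infDist {V : Type*} [NormedAddCommGroup V] [NormedSpace ℝ V]
    {m : ℕ} (a : Fin m → V) (k : Fin m) :
    width a ≤ Metric.infDist (a k) (Submodule.span ℝ (a '' {i | i ≠ k}) : Set V) :=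
  ciInf_le (Set.finite_range _).bddBelow k

theorem abs_coeff_mul_width_le_norm_sum {V : Type*} [NormedAddCommGroup V] [NormedSpace ℝ V]
    {m : ℕ} (a : Fin m → V) (c : Fin m → ℝ) (k : Fin m) :
    |c k| * width a ≤ ‖∑ i, c i • a i‖ := by
  rcases eq_or_ne (c k) 0 with hk | hk
  · simp [hk]
  set s := ∑ i ∈ Finset.univ.erase k, c i • a i with hs
  have hs_mem : s ∈ Submodule.span ℝ (a '' {i | i ≠ k}) :=
    Submodule.sum_mem _ fun i hi => Submodule.smul_mem _ _
      (Submodule.subset_span ⟨i, Finset.ne_of_mem_erase hi, rfl⟩)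
  have h_sum : ∑ i, c i • a i = c k • (a k - (-(c k)⁻¹) • s) := by
    rw [← Finset.add_sum_erase _ _ (Finset.mem_univ k), ← hs, neg_smul, sub_neg_eq_add,
      smul_add, smul_inv_smul₀ hk]
  rw [h_sum, norm_smul, Real.norm_eq_abs, ← dist_eq_norm]
  gcongr
  exact (width_le_infDist a k).trans (Metric.infDist_le_dist_of_mem (Submodule.smul_mem _ _ hs_mem))

theorem sum_smul_matrixColumns {r : ℕ} (A : Matrix (Fin r) (Fin r) ℝ) (c : Fin r → ℝ) :
    ∑ i, c i • matrixColumns A i = WithLp.toLp 2 (A.mulVec c) := by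
  ext k
  simp [matrixColumns, Matrix.mulVec, dotProduct, mul_comm]

theorem inverse_entries_le_inv_width {r : ℕ} (A : Matrix (Fin r) (Fin r) ℝ)
    (hA : 0 < width (matrixColumns A)) :
    IsUnit A ∧ ∀ k j : Fin r, |A⁻¹ k j| ≤ 1 / width (matrixColumns A) := by
  have h_bound (c : Fin r → ℝ) (k : Fin r) :
      |c k| * width (matrixColumns A) ≤ ‖WithLp.toLp 2 (A.mulVec c)‖ :=
    sum_smul_matrixColumns A c ▸ abs_coeff_mul_width_le_norm_sum _ c k
  have h_unit : IsUnit A := by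
    rw [← Matrix.mulVec_injective_iff_isUnit]
    intro x y hxy
    ext k
    have h := h_bound (x - y) k
    rw [Matrix.mulVec_sub, sub_eq_zero.mpr hxy, WithLp.toLp_zero, norm_zero] at h
    have h_abs := nonpos_of_mul_nonpos_left h hA
    exact sub_eq_zero.mp (abs_nonpos_iff.mp h_abs)
  refine ⟨h_unit, fun k j => (le_div_iff₀ hA).mpr ?_⟩
  have h := h_bound (A⁻¹.mulVec (Pi.single j 1)) k
  rw [Matrix.mulVec_mulVec, Matrix.mul_nonsing_inv A ((Matrix.isUnit_iff_isUnit_det A).mp h_unit),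
    Matrix.one_mulVec] at h
  simpa using h
end

section
/- Let Γ be a subset of Euclidean space ℝ^r, let m ≥ 1, and let K > 0. If Width(p_1,…,p_m) ≤ K for every m-tuple (p_1,…,p_m) of points of Γ, then there exists a linear subspace W ⊂ ℝ^r of dimension at most m − 1 such that every point of Γ lies within distance K of W, i.e. Γ is contained in the closed K-neighborhood of W. -/
open Function in
/-- Changing one entry of a tuple by an element of the span of the other entries does not change
the Gram determinant. -/
lemma det_gram_update_sub_of_mem_span {E : Type*} [NormedAddCommGroup E] [InnerProductSpace ℝ E]
    [FiniteDimensional ℝ E] {m : ℕ} (p : Fin m → E) (j : Fin m) (x : E) {w : E}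
    (hw : w ∈ Submodule.span ℝ (p '' {i | i ≠ j})) :
    (Matrix.gram ℝ (update p j (x - w))).det = (Matrix.gram ℝ (update p j x)).det := by
  have hzero : exteriorPower.ιMulti ℝ m (update p j w) = 0 := by
    have hle : Submodule.span ℝ (p '' {i | i ≠ j}) ≤
        LinearMap.ker ((exteriorPower.ιMulti ℝ m).toMultilinearMap.toLinearMap p j) := by
      rw [Submodule.span_le]
      rintro _ ⟨i, hi, rfl⟩
      exact (exteriorPower.ιMulti ℝ m).map_update_self p (Ne.symm hi)
    exact hle hw
  rw [← exteriorPower.inner_ιMulti_self, ← exteriorPower.inner_ιMulti_self,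
    AlternatingMap.map_update_sub, hzero, sub_zero]

open Function in
/-- If `h` is orthogonal to every entry of `p` except the `j`-th, replacing the `j`-th entry by `h`
gives the Gram determinant `‖h‖ ^ 2` times the Gram determinant of the other entries. -/
lemma det_gram_update_of_orthogonal {E ι : Type*} [NormedAddCommGroup E] [InnerProductSpace ℝ E]
    [Fintype ι] [DecidableEq ι] (p : ι → E) (j : ι) {h : E}
    (hh : ∀ i ≠ j, inner ℝ h (p i) = 0) :
    (Matrix.gram ℝ (update p j h)).det =
      ‖h‖ ^ 2 * (Matrix.gram ℝ (update p j 0)).adjugate j j := by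
  have hrow : Matrix.gram ℝ (update p j h) =
      (Matrix.gram ℝ (update p j 0)).updateRow j (‖h‖ ^ 2 • Pi.single j 1) := by
    ext a b
    by_cases ha : a = j <;> by_cases hb : b = j
    · subst ha; subst hb; simp
    · subst ha; simp [hb, hh b hb]
    · subst hb; simp [ha, real_inner_comm h (p a), hh a ha]
    · simp [ha, hb]
  rw [hrow, Matrix.det_updateRow_smul, Matrix.adjugate_apply]

lemma Submodule.infDist_eq_norm_sub_starProjection {E : Type*} [NormedAddCommGroup E]
    [InnerProductSpace ℝ E] (W : Submodule ℝ E) [W.HasOrthogonalProjection] (x : E) :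
    Metric.infDist x W = ‖x - W.starProjection x‖ := by
  rw [W.starProjection_minimal, Metric.infDist_eq_iInf]
  simp only [dist_eq_norm]
  rfl

open Function in
/-- The Gram determinant is the squared height over the span of the other entries times the Gram
determinant of the other entries. -/
lemma det_gram_update_eq_infDist_sq_mul {E : Type*} [NormedAddCommGroup E] [InnerProductSpace ℝ E]
    [FiniteDimensional ℝ E] {m : ℕ} (p : Fin m → E) (j : Fin m) (x : E) :
    (Matrix.gram ℝ (update p j x)).det =
      Metric.infDist x (Submodule.span ℝ (p '' {i | i ≠ j}) : Set E) ^ 2 *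
        (Matrix.gram ℝ (update p j 0)).adjugate j j := by
  set W := Submodule.span ℝ (p '' {i | i ≠ j})
  rw [W.infDist_eq_norm_sub_starProjection,
    ← det_gram_update_sub_of_mem_span p j x (W.starProjection_apply_mem x)]
  exact det_gram_update_of_orthogonal p j fun i hi =>
    W.starProjection_inner_eq_zero x _ (Submodule.subset_span ⟨i, hi, rfl⟩)

/-- A finite set all of whose `m`-tuples have width at most `K` lies in the `K`-neighborhood of a
subspace of dimension at most `m - 1`. -/
lemma exists_submodule_infDist_le_of_finite {E : Type*} [NormedAddCommGroup E]
    [InnerProductSpace ℝ E] [FiniteDimensional ℝ E] {m : ℕ} (hm : 1 ≤ m) {F : Set E}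
    (hF : F.Finite) {K : ℝ} (hK : 0 ≤ K)
    (hwidth : ∀ p : Fin m → E, (∀ i, p i ∈ F) → width p ≤ K) :
    ∃ W : Submodule ℝ E, Module.finrank ℝ W ≤ m - 1 ∧
      ∀ x ∈ F, Metric.infDist x (W : Set E) ≤ K := by
  by_cases hdim : Module.finrank ℝ (Submodule.span ℝ F) ≤ m - 1
  · refine ⟨Submodule.span ℝ F, hdim, fun x hx => ?_⟩
    rwa [Metric.infDist_zero_of_mem (Submodule.subset_span hx)]
  obtain ⟨f, hfF, -, hf⟩ := Submodule.exists_fun_fin_finrank_span_eq ℝ F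
  let e : Fin m → Fin (Module.finrank ℝ (Submodule.span ℝ F)) := Fin.castLE (by omega)
  have hfin : {p : Fin m → E | ∀ i, p i ∈ F}.Finite := by
    simpa [Set.pi] using Set.Finite.pi' fun _ : Fin m => hF
  obtain ⟨p, hpF, hmax⟩ := Set.exists_max_image _ (fun p => (Matrix.gram ℝ p).det) hfin
    ⟨f ∘ e, fun i => hfF (e i)⟩
  have hpos : 0 < (Matrix.gram ℝ p).det :=
    (Matrix.posDef_gram_of_linearIndependent
      (hf.comp e (Fin.castLE_injective _))).det_pos.trans_le (hmax _ fun i => hfF (e i))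
  have : Nonempty (Fin m) := ⟨⟨0, hm⟩⟩
  obtain ⟨j, hj⟩ := exists_eq_ciInf_of_finite (f := fun j : Fin m => Metric.infDist (p j)
    (Submodule.span ℝ (p '' {i | i ≠ j}) : Set E))
  have hjK := hj.trans_le (hwidth p hpF)
  have hp := det_gram_update_eq_infDist_sq_mul p j (p j)
  rw [Function.update_eq_self] at hp
  refine ⟨Submodule.span ℝ (p '' {i | i ≠ j}), ?_, fun x hx => ?_⟩
  · have hcard := finrank_range_le_card (R := ℝ) fun i : {i // i ≠ j} => p i
    rw [Fintype.card_subtype_compl, Fintype.card_fin, Fintype.card_subtype_eq] at hcard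
    rwa [Set.image_eq_range]
  · have hle := hmax (Function.update p j x) fun i => by
      rcases eq_or_ne i j with rfl | hi
      · simpa using hx
      · simpa [hi] using hpF i
    rw [hp] at hpos
    rw [det_gram_update_eq_infDist_sq_mul, hp] at hle
    have hadj := pos_of_mul_pos_right hpos (sq_nonneg _)
    exact (abs_le_of_sq_le_sq' (le_of_mul_le_mul_right hle hadj) Metric.infDist_nonneg).2.trans hjK

/-- The orthogonal projection onto a subspace of dimension at most `n` is given by `n` vectors of
norm at most one. -/
lemma Submodule.exists_starProjection_eq_sum {E : Type*} [NormedAddCommGroup E]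
    [InnerProductSpace ℝ E] (W : Submodule ℝ E) [FiniteDimensional ℝ W] {n : ℕ}
    (hW : Module.finrank ℝ W ≤ n) :
    ∃ e : Fin n → E, (∀ i, ‖e i‖ ≤ 1) ∧
      ∀ x, W.starProjection x = ∑ i, inner ℝ (e i) x • e i := by
  let b := stdOrthonormalBasis ℝ W
  have hinj := Fin.castLE_injective hW
  let e := Function.extend (Fin.castLE hW) (fun i => (b i : E)) 0
  have he (i) : e (Fin.castLE hW i) = b i := hinj.extend_apply _ _ i
  have he' (i) (hi : i ∉ Set.range (Fin.castLE hW)) : e i = 0 :=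
    Function.extend_apply' _ _ _ hi
  refine ⟨e, fun i => ?_, fun x => ?_⟩
  · by_cases hi : i ∈ Set.range (Fin.castLE hW)
    · obtain ⟨k, rfl⟩ := hi
      rw [he]
      exact (b.orthonormal.1 k).le
    · simp [he' i hi]
  · rw [W.starProjection_apply, b.orthogonalProjectionOnto_apply_eq_sum]
    simp only [AddSubmonoidClass.coe_finsetSum, Submodule.coe_smul]
    exact Fintype.sum_of_injective _ hinj _ _ (fun i hi => by simp [he' i hi])
      fun i => by simp [he]

/-- Being contained in the closed `K`-neighborhood of some subspace of dimension at most `n` can be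
checked on finite subsets. -/
lemma exists_submodule_infDist_le_of_forall_finite {E : Type*} [NormedAddCommGroup E]
    [InnerProductSpace ℝ E] [FiniteDimensional ℝ E] {n : ℕ} {Γ : Set E} {K : ℝ}
    (hfin : ∀ F ⊆ Γ, F.Finite → ∃ W : Submodule ℝ E, Module.finrank ℝ W ≤ n ∧
      ∀ x ∈ F, Metric.infDist x (W : Set E) ≤ K) :
    ∃ W : Submodule ℝ E, Module.finrank ℝ W ≤ n ∧
      ∀ x ∈ Γ, Metric.infDist x (W : Set E) ≤ K := by
  have hcompact : IsCompact (Set.univ.pi fun _ : Fin n => Metric.closedBall (0 : E) 1) :=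
    isCompact_univ_pi fun _ => isCompact_closedBall 0 1
  obtain ⟨e, -, he⟩ := hcompact.inter_iInter_nonempty
    (fun x : Γ => {e : Fin n → E | ‖(x : E) - ∑ i, inner ℝ (e i) (x : E) • e i‖ ≤ K})
    (fun x => isClosed_le (by fun_prop) continuous_const) fun u => by
      obtain ⟨W, hW, hWK⟩ := hfin (Subtype.val '' (u : Set Γ)) (by simp)
        (u.finite_toSet.image _)
      obtain ⟨e, he1, he⟩ := W.exists_starProjection_eq_sum hW
      refine ⟨e, fun i _ => by simpa using he1 i, Set.mem_iInter₂.2 fun x hx => ?_⟩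
      have hxK := hWK x ⟨x, hx, rfl⟩
      rwa [W.infDist_eq_norm_sub_starProjection, he] at hxK
  refine ⟨Submodule.span ℝ (Set.range e),
    by simpa [Set.finrank] using finrank_range_le_card (R := ℝ) e, fun x hx => ?_⟩
  have hmem : ∑ i, inner ℝ (e i) x • e i ∈ Submodule.span ℝ (Set.range e) :=
    Submodule.sum_mem _ fun i _ => Submodule.smul_mem _ _ (Submodule.subset_span ⟨i, rfl⟩)
  refine (Metric.infDist_le_dist_of_mem hmem).trans ?_
  rw [dist_eq_norm]
  exact Set.mem_iInter.1 he ⟨x, hx⟩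

theorem subset_nbhd_of_width_bounded {r m : ℕ} (hm : 1 ≤ m)
    (Γ : Set (EuclideanSpace ℝ (Fin r))) {K : ℝ} (hK : 0 < K)
    (hwidth : ∀ p : Fin m → EuclideanSpace ℝ (Fin r), (∀ i, p i ∈ Γ) → width p ≤ K) :
    ∃ W : Submodule ℝ (EuclideanSpace ℝ (Fin r)),
      Module.finrank ℝ W ≤ m - 1 ∧ ∀ x ∈ Γ, Metric.infDist x (W : Set (EuclideanSpace ℝ (Fin r))) ≤ K := by
  exact exists_submodule_infDist_le_of_forall_finite fun F hF hFfin =>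
    exists_submodule_infDist_le_of_finite hm hFfin hK.le fun p hp =>
      hwidth p fun i => hF (hp i)
end

section
/- Let X and Y be metric spaces and let α : X → Y and β : X → Y be maps such that: (a) β is bornologous, i.e. for every R < ∞ there exists R' < ∞ such that for all x, x' ∈ X with d(x,x') ≤ R one has d(β(x), β(x')) ≤ R'; and (b) α × β maps distant points to distant points, i.e. for every M < ∞ there exists R < ∞ such that for all x_1, x_2 ∈ X with d(x_1,x_2) > R one has d(α(x_1), β(x_2)) > M. Then the Hausdorff distance between the images α(X) and β(X) is finite if and only if sup_{x ∈ X} d(α(x), β(x)) is finite. -/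
theorem hausdorffEdist_finite_iff_sup_dist_finite
    {X Y : Type*} [MetricSpace X] [MetricSpace Y] (α β : X → Y)
    (hβ : ∀ R : ℝ, ∃ R' : ℝ, ∀ x x' : X, dist x x' ≤ R → dist (β x) (β x') ≤ R')
    (hαβ : ∀ M : ℝ, ∃ R : ℝ, ∀ x₁ x₂ : X, R < dist x₁ x₂ → M < dist (α x₁) (β x₂)) :
    EMetric.hausdorffEdist (Set.range α) (Set.range β) ≠ ⊤ ↔
      ∃ S : ℝ, ∀ x : X, dist (α x) (β x) ≤ S := by
  constructor
  · intro h
    obtain ⟨R, hR⟩ := hαβ (Metric.hausdorffDist (Set.range α) (Set.range β) + 1)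
    obtain ⟨R', hR'⟩ := hβ R
    refine ⟨Metric.hausdorffDist (Set.range α) (Set.range β) + 1 + R', fun x => ?_⟩
    obtain ⟨_, ⟨x', rfl⟩, hx'⟩ :=
      Metric.exists_dist_lt_of_hausdorffDist_lt (Set.mem_range_self x) (lt_add_one _) h
    have hxx' : dist x x' ≤ R := not_lt.1 fun hlt => (hR x x' hlt).not_gt hx'
    have hββ := hR' x x' hxx'
    have htri := dist_triangle_right (α x) (β x) (β x')
    linarith
  · rintro ⟨S, hS⟩
    refine ne_top_of_le_ne_top (ENNReal.ofReal_ne_top (r := S))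
      (Metric.hausdorffEDist_le_of_mem_edist ?_ ?_)
    · rintro _ ⟨x, rfl⟩
      exact ⟨β x, Set.mem_range_self x, edist_le_ofReal (dist_nonneg.trans (hS x)) |>.2 (hS x)⟩
    · rintro _ ⟨x, rfl⟩
      refine ⟨α x, Set.mem_range_self x, edist_le_ofReal (dist_nonneg.trans (hS x)) |>.2 ?_⟩
      exact (dist_comm _ _).trans_le (hS x)
end

section
/- Let C > 0 and let γ : ℝ → ℝ^n be a (1,C)-quasi-geodesic into Euclidean n-space with γ(0) = 0. Then the limit lim_{t→∞} γ(t)/t exists, and the limit vector v satisfies ‖v‖ = 1. -/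
open Filter

/-- A `(1,C)`-quasi-geodesic in a metric space. -/
def IsQuasiGeodesic {X : Type*} [MetricSpace X] (C : ℝ) (γ : ℝ → X) : Prop :=
  ∀ t₁ t₂ : ℝ, |t₁ - t₂| - C ≤ dist (γ t₁) (γ t₂) ∧ dist (γ t₁) (γ t₂) ≤ |t₁ - t₂| + C

/-- Along a `(1,C)`-quasi-geodesic issuing from the origin, the norm at time `t` is `t` up to `C`. -/
theorem IsQuasiGeodesic.abs_norm_sub_le {E : Type*} [NormedAddCommGroup E] {C : ℝ} {γ : ℝ → E}
    (hγ : IsQuasiGeodesic C γ) (h0 : γ 0 = 0) {t : ℝ} (ht : 0 ≤ t) : |‖γ t‖ - t| ≤ C := by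
  have h := hγ t 0
  rw [h0, dist_zero_right, sub_zero, abs_of_nonneg ht] at h
  exact abs_le.2 ⟨by linarith [h.1], by linarith [h.2]⟩

/-- The directions of a `(1,C)`-quasi-geodesic from the origin after time `s` are `O(√(C / s))`-close. -/
theorem IsQuasiGeodesic.dist_inv_smul_sq_le {E : Type*} [NormedAddCommGroup E]
    [InnerProductSpace ℝ E] {C : ℝ} (hC : 0 < C) {γ : ℝ → E}
    (hγ : IsQuasiGeodesic C γ) (h0 : γ 0 = 0) {s t : ℝ} (hs : C ≤ s) (hst : s ≤ t) :
    dist (t⁻¹ • γ t) (s⁻¹ • γ s) ^ 2 ≤ 10 * C / s := by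
  have hs0 : 0 < s := hC.trans_le hs
  have ht0 : 0 < t := hs0.trans_le hst
  obtain ⟨ht1, ht2⟩ := abs_le.1 (hγ.abs_norm_sub_le h0 ht0.le)
  obtain ⟨hs1, hs2⟩ := abs_le.1 (hγ.abs_norm_sub_le h0 hs0.le)
  have hd := (hγ t s).2
  rw [abs_of_nonneg (sub_nonneg.2 hst), dist_eq_norm] at hd
  have hpol := norm_sub_sq_real (γ t) (γ s)
  have hd' : ‖γ t - γ s‖ ^ 2 ≤ (t - s + C) ^ 2 := by gcongr
  have hta : (t - C) ^ 2 ≤ ‖γ t‖ ^ 2 := pow_le_pow_left₀ (by linarith) (by linarith) 2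
  have hsa : (s - C) ^ 2 ≤ ‖γ s‖ ^ 2 := pow_le_pow_left₀ (by linarith) (by linarith) 2
  have hinner : t * s - 2 * t * C ≤ inner ℝ (γ t) (γ s) := by nlinarith
  have hCs : C / s ≤ 1 := (div_le_one hs0).2 hs
  have hCs0 : 0 ≤ C / s := by positivity
  have hnt : ‖t⁻¹ • γ t‖ ≤ 1 + C / s := by
    rw [norm_smul, Real.norm_of_nonneg (by positivity)]
    calc t⁻¹ * ‖γ t‖ ≤ t⁻¹ * (t + C) := by gcongr; linarith
      _ = 1 + C / t := by field_simp
      _ ≤ 1 + C / s := by gcongr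
  have hns : ‖s⁻¹ • γ s‖ ≤ 1 + C / s := by
    rw [norm_smul, Real.norm_of_nonneg (by positivity)]
    calc s⁻¹ * ‖γ s‖ ≤ s⁻¹ * (s + C) := by gcongr; linarith
      _ = 1 + C / s := by field_simp
  have hi : 1 - 2 * (C / s) ≤ inner ℝ (t⁻¹ • γ t) (s⁻¹ • γ s) := by
    rw [real_inner_smul_left, real_inner_smul_right]
    calc 1 - 2 * (C / s) = t⁻¹ * (s⁻¹ * (t * s - 2 * t * C)) := by field_simp
      _ ≤ _ := by gcongr
  have hnt' := pow_le_pow_left₀ (norm_nonneg _) hnt 2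
  have hns' := pow_le_pow_left₀ (norm_nonneg _) hns 2
  rw [dist_eq_norm, norm_sub_sq_real, mul_div_assoc]
  nlinarith

theorem limit_direction_of_quasiGeodesic {n : ℕ}
    {C : ℝ} (hC : 0 < C) (γ : ℝ → EuclideanSpace ℝ (Fin n))
    (hγ : IsQuasiGeodesic C γ) (h0 : γ 0 = 0) :
    ∃ v : EuclideanSpace ℝ (Fin n), ‖v‖ = 1 ∧
      Tendsto (fun t : ℝ => t⁻¹ • γ t) atTop (nhds v) := by
  have hcauchy : CauchySeq (fun t : ℝ => t⁻¹ • γ t) := by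
    refine Metric.cauchySeq_iff'.2 fun ε hε => ?_
    have hlim : Tendsto (fun s : ℝ => 10 * C / s) atTop (nhds 0) :=
      tendsto_const_nhds.div_atTop tendsto_id
    obtain ⟨N, hN, hCN⟩ :=
      ((hlim.eventually_lt_const (pow_pos hε 2)).and (eventually_ge_atTop C)).exists
    exact ⟨N, fun t ht => lt_of_pow_lt_pow_left₀ 2 hε.le
      ((hγ.dist_inv_smul_sq_le hC h0 hCN ht).trans_lt hN)⟩
  obtain ⟨v, hv⟩ := cauchySeq_tendsto_of_complete hcauchy
  refine ⟨v, tendsto_nhds_unique hv.norm ?_, hv⟩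
  rw [tendsto_iff_dist_tendsto_zero]
  have hlim : Tendsto (fun t : ℝ => C / t) atTop (nhds 0) :=
    tendsto_const_nhds.div_atTop tendsto_id
  refine squeeze_zero' (Eventually.of_forall fun _ => dist_nonneg) ?_ hlim
  filter_upwards [eventually_gt_atTop 0] with t ht
  have hEq : ‖t⁻¹ • γ t‖ - 1 = (‖γ t‖ - t) / t := by
    rw [norm_smul, Real.norm_of_nonneg (by positivity)]
    field_simp
  rw [Real.dist_eq, hEq, abs_div, abs_of_pos ht]
  gcongr
  exact hγ.abs_norm_sub_le h0 ht.le
end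

section
/- Every (1,C)-quasi-geodesic in Euclidean n-space has a unique blowdown, and this blowdown is a line: if C ≥ 0 and γ : ℝ → ℝ^n satisfies |t₁ − t₂| − C ≤ ‖γ(t₁) − γ(t₂)‖ ≤ |t₁ − t₂| + C for all t₁, t₂ ∈ ℝ, then there exists a vector v ∈ ℝ^n with ‖v‖ = 1 such that for every t ∈ ℝ the rescaled points (γ(h t) − γ(0))/h converge to t·v as h → ∞ (convergence along all of h → ∞, not merely along a subsequence). -/
open Filter

theorem abs_sq_sub_sq_le_of_abs_sub_abs_le {x r C : ℝ} (h : |x - abs r| ≤ C) :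
    |x ^ 2 - r ^ 2| ≤ 2 * |r| * C + C ^ 2 := by
  have hC : 0 ≤ C := (abs_nonneg _).trans h
  have hr := abs_nonneg r
  rw [abs_le] at h
  rw [← sq_abs r, abs_le]
  constructor <;> nlinarith

theorem norm_inv_smul_sub_inv_smul_sq_le {E : Type*} [NormedAddCommGroup E]
    [InnerProductSpace ℝ E] {a b : E} {s t C : ℝ} (hs : 0 < |s|) (hCs : C ≤ |s|)
    (hst : |s| ≤ |t|) (ha : |‖a‖ - abs s| ≤ C) (hb : |‖b‖ - abs t| ≤ C)
    (hab : |‖a - b‖ - abs (s - t)| ≤ C) :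
    ‖s⁻¹ • a - t⁻¹ • b‖ ^ 2 ≤ 17 * C / |s| := by
  have hC : 0 ≤ C := (abs_nonneg _).trans ha
  have ht : 0 < |t| := hs.trans_le hst
  have hs0 : s ≠ 0 := abs_pos.mp hs
  have ht0 : t ≠ 0 := abs_pos.mp ht
  have h₁ := abs_sq_sub_sq_le_of_abs_sub_abs_le ha
  have h₂ := abs_sq_sub_sq_le_of_abs_sub_abs_le hb
  have h₃ := abs_sq_sub_sq_le_of_abs_sub_abs_le hab
  have hsub : |s - t| ≤ |s| + |t| := abs_sub s t
  have hsC : C * C ≤ C * |s| := mul_le_mul_of_nonneg_left hCs hC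
  have htC : C * |s| ≤ C * |t| := mul_le_mul_of_nonneg_left hst hC
  have hdC : C * |s - t| ≤ C * (|s| + |t|) := mul_le_mul_of_nonneg_left hsub hC
  set x := ‖a‖ ^ 2 - s ^ 2 with hx
  set y := ‖b‖ ^ 2 - t ^ 2 with hy
  set z := ‖a - b‖ ^ 2 - (s - t) ^ 2 with hz
  have key : ‖s⁻¹ • a - t⁻¹ • b‖ ^ 2
      = x / (s * s) + y / (t * t) - x / (s * t) - y / (s * t) + z / (s * t) := by
    rw [hx, hy, hz, norm_sub_sq_real, norm_sub_sq_real, norm_smul, norm_smul,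
      real_inner_smul_left, real_inner_smul_right, mul_pow, mul_pow, Real.norm_eq_abs,
      Real.norm_eq_abs, sq_abs, sq_abs]
    field_simp
    ring
  have bound : ∀ w k p : ℝ, 0 ≤ k → |s| ≤ |p| → |w| ≤ k * (C * |t|) →
      |w / (p * t)| ≤ k * (C / |s|) := by
    intro w k p hk hp hw
    have hp' : 0 < |p| := hs.trans_le hp
    calc |w / (p * t)| = |w| / (|p| * |t|) := by rw [abs_div, abs_mul]
      _ ≤ k * (C * |t|) / (|s| * |t|) := by gcongr
      _ = k * (C / |s|) := by field_simp
  have b₁ : |x / (s * s)| ≤ 3 * (C / |s|) := by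
    calc |x / (s * s)| = |x| / (|s| * |s|) := by rw [abs_div, abs_mul]
      _ ≤ 3 * (C * |s|) / (|s| * |s|) := by gcongr; linarith
      _ = 3 * (C / |s|) := by field_simp
  have b₂ := bound y 3 t (by norm_num) hst (by linarith)
  have b₃ := bound x 3 s (by norm_num) le_rfl (by linarith)
  have b₄ := bound y 3 s (by norm_num) le_rfl (by linarith)
  have b₅ := bound z 5 s (by norm_num) le_rfl (by linarith)
  rw [key, mul_div_assoc]
  linarith [abs_le.mp b₁, abs_le.mp b₂, abs_le.mp b₃, abs_le.mp b₄, abs_le.mp b₅]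

theorem IsQuasiGeodesic.abs_norm_sub_sub_le {E : Type*} [NormedAddCommGroup E] {C : ℝ}
    {γ : ℝ → E} (hγ : IsQuasiGeodesic C γ) (s t : ℝ) : |‖γ s - γ t‖ - abs (s - t)| ≤ C := by
  have h := hγ s t
  rw [dist_eq_norm] at h
  rw [abs_le]
  constructor <;> linarith [h.1, h.2]

theorem IsQuasiGeodesic.exists_tendsto_cobounded {E : Type*} [NormedAddCommGroup E]
    [InnerProductSpace ℝ E] [CompleteSpace E] {C : ℝ} {γ : ℝ → E} (hγ : IsQuasiGeodesic C γ) :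
    ∃ v : E, Tendsto (fun s : ℝ => s⁻¹ • (γ s - γ 0)) (Bornology.cobounded ℝ) (nhds v) := by
  have hC : 0 ≤ C := (abs_nonneg _).trans (hγ.abs_norm_sub_sub_le 0 0)
  have h0 : ∀ s, |‖γ s - γ 0‖ - abs s| ≤ C := fun s => by
    simpa using hγ.abs_norm_sub_sub_le s 0
  rw [← cauchy_map_iff_exists_tendsto, Metric.cauchy_iff]
  refine ⟨inferInstance, fun ε hε => ?_⟩
  let R := 17 * C / ε ^ 2 + C + 1
  refine ⟨(fun s : ℝ => s⁻¹ • (γ s - γ 0)) '' {s | R ≤ ‖s‖},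
    image_mem_map (eventually_cobounded_le_norm R), ?_⟩
  have main : ∀ s t : ℝ, R ≤ |s| → |s| ≤ |t| →
      dist (s⁻¹ • (γ s - γ 0)) (t⁻¹ • (γ t - γ 0)) < ε := by
    intro s t hR hst
    have hq : 0 ≤ 17 * C / ε ^ 2 := by positivity
    have hs : 0 < |s| := by linarith
    have hlt : 17 * C / ε ^ 2 < |s| := by linarith
    have h := norm_inv_smul_sub_inv_smul_sq_le hs (by linarith) hst (h0 s) (h0 t)
      (by simpa using hγ.abs_norm_sub_sub_le s t)
    rw [dist_eq_norm]
    refine lt_of_pow_lt_pow_left₀ 2 hε.le (h.trans_lt ?_)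
    rw [div_lt_iff₀ (by positivity)] at hlt ⊢
    linarith
  rintro _ ⟨s, hs, rfl⟩ _ ⟨t, ht, rfl⟩
  rcases le_total |s| |t| with hst | hts
  · exact main s t hs hst
  · rw [dist_comm]
    exact main t s ht hts

theorem IsQuasiGeodesic.tendsto_norm_inv_smul {E : Type*} [NormedAddCommGroup E]
    [NormedSpace ℝ E] {C : ℝ} {γ : ℝ → E} (hγ : IsQuasiGeodesic C γ) :
    Tendsto (fun s : ℝ => ‖s⁻¹ • (γ s - γ 0)‖) (Bornology.cobounded ℝ) (nhds 1) := by
  rw [tendsto_iff_dist_tendsto_zero]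
  have hlim : Tendsto (fun s : ℝ => C * ‖s‖⁻¹) (Bornology.cobounded ℝ) (nhds 0) := by
    simpa using (tendsto_norm_cobounded_atTop (E := ℝ)).inv_tendsto_atTop.const_mul C
  refine squeeze_zero' (Eventually.of_forall fun _ => dist_nonneg) ?_ hlim
  filter_upwards [eventually_cobounded_le_norm (E := ℝ) 1] with s hs
  have hs' : 0 < |s| := one_pos.trans_le hs
  have h : |‖γ s - γ 0‖ - abs s| ≤ C := by simpa using hγ.abs_norm_sub_sub_le s 0
  have heq : ‖s⁻¹ • (γ s - γ 0)‖ - 1 = (‖γ s - γ 0‖ - |s|) * |s|⁻¹ := by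
    rw [norm_smul, norm_inv, Real.norm_eq_abs]
    field_simp
  rw [Real.dist_eq, heq, abs_mul, abs_inv, abs_abs, Real.norm_eq_abs]
  gcongr

/-- Every `(1,C)`-quasi-geodesic in Euclidean `n`-space has a unique blowdown,
and the blowdown is a line. -/
theorem quasiGeodesic_unique_blowdown_is_line {n : ℕ}
    {C : ℝ} (hC : 0 ≤ C) (γ : ℝ → EuclideanSpace ℝ (Fin n))
    (hγ : IsQuasiGeodesic C γ) :
    ∃ v : EuclideanSpace ℝ (Fin n), ‖v‖ = 1 ∧
      ∀ t : ℝ, Tendsto (fun h : ℝ => h⁻¹ • (γ (h * t) - γ 0)) atTop (nhds (t • v)) := by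
  obtain ⟨v, hv⟩ := hγ.exists_tendsto_cobounded
  refine ⟨v, tendsto_nhds_unique hv.norm hγ.tendsto_norm_inv_smul, fun t => ?_⟩
  rcases eq_or_ne t 0 with rfl | ht
  · simp
  have hmul : Tendsto (fun h : ℝ => h * t) atTop (Bornology.cobounded ℝ) := by
    rw [← tendsto_norm_atTop_iff_cobounded]
    simp only [norm_mul]
    exact tendsto_norm_atTop_atTop.atTop_mul_const (norm_pos_iff.mpr ht)
  refine ((hv.comp hmul).const_smul t).congr fun h => ?_
  simp only [Function.comp_apply, smul_smul, mul_inv]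
  congr 1
  field_simp
end

section
/- Let E be a real normed vector space, C ≥ 0, and let γ : ℝ → E be a (1,C)-quasi-geodesic. Suppose h_j → ∞ is a sequence of positive reals and σ : ℝ → E is such that for every t ∈ ℝ the points (γ(h_j t) − γ(0))/h_j converge to σ(t) as j → ∞. Then σ is a geodesic line parametrization: ‖σ(t) − σ(s)‖ = |t − s| for all t, s ∈ ℝ. -/
open Filter

/-- Any blowdown of a `(1,C)`-quasi-geodesic in a real normed vector space is a geodesic
line parametrization. -/
theorem blowdown_of_quasiGeodesic_isometric
    {E : Type*} [NormedAddCommGroup E] [NormedSpace ℝ E]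
    {C : ℝ} (hC : 0 ≤ C) (γ : ℝ → E) (hγ : IsQuasiGeodesic C γ)
    (h : ℕ → ℝ) (hpos : ∀ j, 0 < h j) (htop : Tendsto h atTop atTop)
    (σ : ℝ → E)
    (hconv : ∀ t : ℝ, Tendsto (fun j => (h j)⁻¹ • (γ (h j * t) - γ 0)) atTop (nhds (σ t))) :
    ∀ t s : ℝ, ‖σ t - σ s‖ = |t - s| := by
  intro t s
  have hnorm : Tendsto (fun j => (h j)⁻¹ * dist (γ (h j * t)) (γ (h j * s))) atTop
      (nhds ‖σ t - σ s‖) := by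
    refine ((hconv t).sub (hconv s)).norm.congr fun j => ?_
    rw [← smul_sub, sub_sub_sub_cancel_right, norm_smul, dist_eq_norm,
      Real.norm_of_nonneg (inv_nonneg.2 (hpos j).le)]
  have herr : Tendsto (fun j => (h j)⁻¹ * C) atTop (nhds 0) := by
    simpa using htop.inv_tendsto_atTop.mul_const C
  have hscale (j : ℕ) : (h j)⁻¹ * |h j * t - h j * s| = |t - s| := by
    rw [← mul_sub, abs_mul, abs_of_pos (hpos j), inv_mul_cancel_left₀ (hpos j).ne']
  refine tendsto_nhds_unique hnorm (tendsto_of_tendsto_of_tendsto_of_le_of_le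
    (g := fun j => |t - s| - (h j)⁻¹ * C) (h := fun j => |t - s| + (h j)⁻¹ * C)
    (by simpa using herr.const_sub |t - s|) (by simpa using herr.const_add |t - s|)
    (fun j => ?_) fun j => ?_)
  · simpa only [mul_sub (h j)⁻¹ |_| C, hscale] using
      mul_le_mul_of_nonneg_left (hγ (h j * t) (h j * s)).1 (inv_nonneg.2 (hpos j).le)
  · simpa only [mul_add, hscale] using
      mul_le_mul_of_nonneg_left (hγ (h j * t) (h j * s)).2 (inv_nonneg.2 (hpos j).le)
end

section
/- Define β₁, β₂, β₁₂, β₁₁₂ : ℝ → ℝ by β₁(t) = 2/cosh(t), β₂(t) = 2·tanh(t) − t, β₁₂(t) = t/cosh(t), and β₁₁₂(t) = (2/3)·tanh(t) − t/(3·cosh(t)²), and write β̇₁(t) = −(1/2)·β₁(t)·β₂(t) − β₁₂(t) and β̇₂(t) = (1/2)·β₁(t)² − 1. Then for every t ∈ ℝ: the function β₁₂ has derivative (1/2)·(β₁(t)·β̇₂(t) − β₂(t)·β̇₁(t)) at t, and the function β₁₁₂ has derivative (1/12)·β₁(t)²·β̇₂(t) − ((1/12)·β₁(t)·β₂(t)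 + (1/2)·β₁₂(t))·β̇₁(t) at t. -/
/-- First horizontal coordinate of the non-line infinite Engel geodesic. -/
noncomputable def β₁ (t : ℝ) : ℝ := 2 / Real.cosh t

/-- Second horizontal coordinate of the non-line infinite Engel geodesic. -/
noncomputable def β₂ (t : ℝ) : ℝ := 2 * Real.tanh t - t

/-- Degree-2 coordinate of the non-line infinite Engel geodesic. -/
noncomputable def β₁₂ (t : ℝ) : ℝ := t / Real.cosh t

/-- Degree-3 coordinate of the non-line infinite Engel geodesic. -/
noncomputable def β₁₁₂ (t : ℝ) : ℝ := (2/3) * Real.tanh t - t / (3 * (Real.cosh t)^2)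

/-- Velocity of the first horizontal coordinate. -/
noncomputable def βdot₁ (t : ℝ) : ℝ := -(1/2) * β₁ t * β₂ t - β₁₂ t

/-- Velocity of the second horizontal coordinate. -/
noncomputable def βdot₂ (t : ℝ) : ℝ := (1/2) * (β₁ t)^2 - 1

theorem engel_geodesic_horizontality :
    ∀ t : ℝ,
      HasDerivAt β₁₂ ((1/2) * (β₁ t * βdot₂ t - β₂ t * βdot₁ t)) t ∧
      HasDerivAt β₁₁₂
        ((1/12) * (β₁ t)^2 * βdot₂ t - ((1/12) * β₁ t * β₂ t + (1/2) * β₁₂ t) * βdot₁ t) t := by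
  intro t
  have hc : Real.cosh t ≠ 0 := (Real.cosh_pos t).ne'
  have hs : Real.sinh t ^ 2 = Real.cosh t ^ 2 - 1 := Real.sinh_sq t
  have htanh : HasDerivAt Real.tanh
      ((Real.cosh t * Real.cosh t - Real.sinh t * Real.sinh t) / Real.cosh t ^ 2) t := by
    rw [show Real.tanh = fun x => Real.sinh x / Real.cosh x from
      funext Real.tanh_eq_sinh_div_cosh]
    exact (Real.hasDerivAt_sinh t).fun_div (Real.hasDerivAt_cosh t) hc
  constructor
  · refine ((hasDerivAt_id' t).fun_div (Real.hasDerivAt_cosh t) hc).congr_deriv ?_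
    simp only [β₁, β₂, β₁₂, βdot₁, βdot₂, Real.tanh_eq_sinh_div_cosh]
    field_simp
    ring_nf
    simp only [hs]
    ring
  · refine ((htanh.const_mul (2 / 3)).fun_sub ((hasDerivAt_id' t).fun_div
      (((Real.hasDerivAt_cosh t).fun_pow 2).const_mul 3)
      (mul_ne_zero three_ne_zero (pow_ne_zero 2 hc)))).congr_deriv ?_
    simp only [β₁, β₂, β₁₂, βdot₁, βdot₂, Real.tanh_eq_sinh_div_cosh]
    field_simp
    ring_nf
    simp only [hs]
    ring
end

section
/- Define β₁, β₂, β₁₂, α₁₂₂ : ℝ → ℝ by β₁(t) = 2/cosh(t), β₂(t) = 2·tanh(t) − t, β₁₂(t) = t/cosh(t), and α₁₂₂(t) = (t² + 4)/(6·cosh(t)) + t·sinh(t)/(3·cosh(t)²), and write β̇₁(t) = −(1/2)·β₁(t)·β₂(t) − β₁₂(t) and β̇₂(t) = (1/2)·β₁(t)² − 1. Then α₁₂₂(0) = 2/3 and for every t ∈ ℝ the function α₁₂₂ has derivative (1/12)·β₂(t)²·β̇₁(t) − ((1/12)·β₁(t)·β₂(t) − (1/2)·β₁₂(t))·β̇₂(t)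 at t; explicitly, this derivative equals 2t/(3·cosh(t)³) − (t² + 2)·sinh(t)/(6·cosh(t)²). -/
/-- The extra degree-3 coordinate of the lift of the Engel geodesic to the
rank-2, step-4 Carnot group. -/
noncomputable def α₁₂₂ (t : ℝ) : ℝ :=
  (t^2 + 4) / (6 * Real.cosh t) + t * Real.sinh t / (3 * (Real.cosh t)^2)

theorem velocity_eq (t : ℝ) :
    (1/12) * (β₂ t)^2 * βdot₁ t - ((1/12) * β₁ t * β₂ t - (1/2) * β₁₂ t) * βdot₂ t
      = 2 * t / (3 * (Real.cosh t)^3) - (t^2 + 2) * Real.sinh t / (6 * (Real.cosh t)^2) := by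
  have hc : Real.cosh t ≠ 0 := (Real.cosh_pos t).ne'
  have hs : Real.sinh t ^ 2 = Real.cosh t ^ 2 - 1 := Real.sinh_sq t
  simp only [βdot₁, βdot₂, β₁, β₂, β₁₂, Real.tanh_eq_sinh_div_cosh]
  field_simp
  grind

theorem hasDerivAt_α₁₂₂ (t : ℝ) :
    HasDerivAt α₁₂₂
      (2 * t / (3 * (Real.cosh t)^3) - (t^2 + 2) * Real.sinh t / (6 * (Real.cosh t)^2)) t := by
  have hc : Real.cosh t ≠ 0 := (Real.cosh_pos t).ne'
  have hs : Real.sinh t ^ 2 = Real.cosh t ^ 2 - 1 := Real.sinh_sq t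
  have h₁ := (((hasDerivAt_id' t).pow 2).add_const 4).div
    ((Real.hasDerivAt_cosh t).const_mul 6) (by positivity)
  have h₂ := ((hasDerivAt_id' t).mul (Real.hasDerivAt_sinh t)).div
    (((Real.hasDerivAt_cosh t).pow 2).const_mul 3) (by simp [hc])
  refine (h₁.add h₂).congr_deriv ?_
  simp only [Pi.mul_apply, Pi.pow_apply]
  field_simp
  grind

theorem lifted_engel_geodesic_missing_coordinate :
    α₁₂₂ 0 = 2/3 ∧
    ∀ t : ℝ,
      HasDerivAt α₁₂₂
        ((1/12) * (β₂ t)^2 * βdot₁ t - ((1/12) * β₁ t * β₂ t - (1/2) * β₁₂ t) * βdot₂ t) t ∧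
      (1/12) * (β₂ t)^2 * βdot₁ t - ((1/12) * β₁ t * β₂ t - (1/2) * β₁₂ t) * βdot₂ t
        = 2 * t / (3 * (Real.cosh t)^3) - (t^2 + 2) * Real.sinh t / (6 * (Real.cosh t)^2) := by
  refine ⟨by norm_num [α₁₂₂], fun t => ⟨?_, velocity_eq t⟩⟩
  rw [velocity_eq]
  exact hasDerivAt_α₁₂₂ t
end
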